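/- arXiv:2112.10815 — 3 statements merged into one kernel-verified Lean document; each statement's English description precedes it below -/
import Mathlib

section
/- (Stage error bound for Runge-Kutta schemes.) Let M, s ∈ ℕ, let X: ℝ^M → ℝ^M be Lipschitz continuous with constant κ > 0, let Δt > 0, and let a_{ij} ∈ ℝ (i,j = 1,…,s). Define D ∈ ℝ^{s×s} by d_{ij} := δ_{ij} − κ Δt |a_{ij}| and assume (a1) D is invertible and (a2) for all x, y ∈ ℝ^s with nonnegative entries, D x ≤ y componentwise implies x ≤ D⁻¹ y componentwise. Let x', x̃' ∈ ℝ^M and let w_1,…,w_s, w̃_1,…,w̃_s ∈ ℝ^M be such that w_i = X(x' + Δt Σ_{j=1}^s a_{ij} w_j) for all i. Define r̃_i := w̃_i − X(x̃' + Δt Σ_{j=1}^s a_{ij} w̃_j). Then for every m = 1,…,s: ‖w_m − w̃_m‖₂ ≤ Σ_{i=1}^s [D⁻¹]_{mi} ( ‖r̃_i‖₂ + κ ‖x' − x̃'‖₂ ). -/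
open Matrix

noncomputable section

/-- Stage error bound for Runge-Kutta schemes: the stage errors `‖w_m - w̃_m‖₂` of an
`s`-stage Runge-Kutta step for a Lipschitz vector field `X` are bounded in terms of the
stage residuals `r̃_i = w̃_i - X(x̃' + Δt Σ_j a_{ij} w̃_j)` and the state error `‖x' - x̃'‖₂`. -/
theorem rk_stage_error_bound (M s : ℕ)
    (X : EuclideanSpace ℝ (Fin M) → EuclideanSpace ℝ (Fin M))
    (κ : ℝ) (hκ : 0 < κ)
    (hLip : ∀ x y : EuclideanSpace ℝ (Fin M), ‖X x - X y‖ ≤ κ * ‖x - y‖)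
    (Δt : ℝ) (hΔt : 0 < Δt)
    (a : Fin s → Fin s → ℝ)
    (D : Matrix (Fin s) (Fin s) ℝ)
    (hDdef : ∀ i j, D i j = (if i = j then (1 : ℝ) else 0) - κ * Δt * |a i j|)
    (ha1 : IsUnit D.det)
    (ha2 : ∀ x y : Fin s → ℝ, (∀ i, 0 ≤ x i) → (∀ i, 0 ≤ y i) →
      (∀ i, (D *ᵥ x) i ≤ y i) → ∀ i, x i ≤ (D⁻¹ *ᵥ y) i)
    (xp xtp : EuclideanSpace ℝ (Fin M))
    (w wt : Fin s → EuclideanSpace ℝ (Fin M))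
    (hw : ∀ i, w i = X (xp + Δt • ∑ j, a i j • w j)) :
    ∀ m, ‖w m - wt m‖ ≤
      ∑ i, D⁻¹ m i * (‖wt i - X (xtp + Δt • ∑ j, a i j • wt j)‖ + κ * ‖xp - xtp‖) := by
  intro m
  refine ha2 (fun i => ‖w i - wt i‖)
    (fun i => ‖wt i - X (xtp + Δt • ∑ j, a i j • wt j)‖ + κ * ‖xp - xtp‖)
    (fun i => norm_nonneg _) (fun i => by positivity) (fun i => ?_) m
  have hD : (D *ᵥ fun j => ‖w j - wt j‖) i
      = ‖w i - wt i‖ - κ * (Δt * ∑ j, |a i j| * ‖w j - wt j‖) := by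
    simp only [mulVec, dotProduct, hDdef, sub_mul, Finset.sum_sub_distrib, ite_mul, one_mul,
      zero_mul, Finset.sum_ite_eq, Finset.mem_univ, if_true, Finset.mul_sum, mul_assoc]
  have hsum : ‖∑ j, a i j • (w j - wt j)‖ ≤ ∑ j, |a i j| * ‖w j - wt j‖ :=
    norm_sum_le_of_le _ fun j _ => by rw [norm_smul, Real.norm_eq_abs]
  have harg : (xp + Δt • ∑ j, a i j • w j) - (xtp + Δt • ∑ j, a i j • wt j)
      = (xp - xtp) + Δt • ∑ j, a i j • (w j - wt j) := by
    simp only [smul_sub, Finset.sum_sub_distrib]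
    abel
  have hargs : ‖(xp + Δt • ∑ j, a i j • w j) - (xtp + Δt • ∑ j, a i j • wt j)‖
      ≤ ‖xp - xtp‖ + Δt * ∑ j, |a i j| * ‖w j - wt j‖ := by
    rw [harg]
    refine (norm_add_le _ _).trans ?_
    rw [norm_smul, Real.norm_of_nonneg hΔt.le]
    gcongr
  have hX := (hLip _ _).trans (mul_le_mul_of_nonneg_left hargs hκ.le)
  rw [← hw i] at hX
  have htri := norm_sub_le_norm_sub_add_norm_sub (w i)
    (X (xtp + Δt • ∑ j, a i j • wt j)) (wt i)
  rw [norm_sub_rev (X _) (wt i)] at htri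
  rw [hD]
  linarith
end
end

section
/- (One-step error bound for Runge-Kutta schemes.) Let M, s ∈ ℕ, let X: ℝ^M → ℝ^M be Lipschitz continuous with constant κ > 0, let Δt > 0, and let a_{ij}, b_i ∈ ℝ (i,j = 1,…,s). Define D ∈ ℝ^{s×s} by d_{ij} := δ_{ij} − κ Δt |a_{ij}| and assume (a1) D is invertible and (a2) for all x, y ∈ ℝ^s with nonnegative entries, D x ≤ y componentwise implies x ≤ D⁻¹ y componentwise. Let x', x ∈ ℝ^M and w_1,…,w_s ∈ ℝ^M satisfy w_i = X(x' + Δt Σ_{j=1}^s a_{ij} w_j) for all i and x = x' + Δt Σ_{i=1}^s b_i w_i. Let x̃', x̃ ∈ ℝ^M and w̃_1,…,w̃_s ∈ ℝ^M be arbitrary and define the residuals r̃_i := w̃_i − X(x̃' + Δt Σ_{j=1}^s a_{ij} w̃_j) and r̃_x := x̃ − x̃' − Δt Σ_{i=1}^s b_i w̃_i. Then, with c₁ := 1 + κ Δt Σ_{m=1}^s |b_m| Σ_{i=1}^s [D⁻¹]_{mi}, it holds: ‖x − x̃‖₂ ≤ c₁ ‖x' − x̃'‖₂ + Δt Σ_{m=1}^s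 |b_m| Σ_{i=1}^s [D⁻¹]_{mi} ‖r̃_i‖₂ + ‖r̃_x‖₂. -/
open Matrix

noncomputable section

/-- One-step error bound for Runge-Kutta schemes: the error after one Runge-Kutta step is
bounded by `c₁` times the previous state error plus weighted stage residuals
`r̃_i = w̃_i - X(x̃' + Δt Σ_j a_{ij} w̃_j)` plus the state residual
`r̃_x = x̃ - x̃' - Δt Σ_i b_i w̃_i`, where
`c₁ = 1 + κ Δt Σ_m |b_m| Σ_i [D⁻¹]_{mi}`. -/
theorem rk_one_step_error_bound (M s : ℕ)
    (X : EuclideanSpace ℝ (Fin M) → EuclideanSpace ℝ (Fin M))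
    (κ : ℝ) (hκ : 0 < κ)
    (hLip : ∀ x y : EuclideanSpace ℝ (Fin M), ‖X x - X y‖ ≤ κ * ‖x - y‖)
    (Δt : ℝ) (hΔt : 0 < Δt)
    (a : Fin s → Fin s → ℝ) (b : Fin s → ℝ)
    (D : Matrix (Fin s) (Fin s) ℝ)
    (hDdef : ∀ i j, D i j = (if i = j then (1 : ℝ) else 0) - κ * Δt * |a i j|)
    (ha1 : IsUnit D.det)
    (ha2 : ∀ x y : Fin s → ℝ, (∀ i, 0 ≤ x i) → (∀ i, 0 ≤ y i) →
      (∀ i, (D *ᵥ x) i ≤ y i) → ∀ i, x i ≤ (D⁻¹ *ᵥ y) i)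
    (xp x : EuclideanSpace ℝ (Fin M)) (w : Fin s → EuclideanSpace ℝ (Fin M))
    (hw : ∀ i, w i = X (xp + Δt • ∑ j, a i j • w j))
    (hx : x = xp + Δt • ∑ i, b i • w i)
    (xtp xt : EuclideanSpace ℝ (Fin M)) (wt : Fin s → EuclideanSpace ℝ (Fin M)) :
    ‖x - xt‖ ≤
      (1 + κ * Δt * ∑ m, |b m| * ∑ i, D⁻¹ m i) * ‖xp - xtp‖
        + Δt * ∑ m, |b m| * ∑ i, D⁻¹ m i * ‖wt i - X (xtp + Δt • ∑ j, a i j • wt j)‖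
        + ‖xt - xtp - Δt • ∑ i, b i • wt i‖ := by
  set E := ‖xp - xtp‖
  set r : Fin s → ℝ := fun i => ‖wt i - X (xtp + Δt • ∑ j, a i j • wt j)‖
  set e : Fin s → ℝ := fun i => ‖w i - wt i‖ with he
  have hE : 0 ≤ E := norm_nonneg _
  have hstage : ∀ i, e i ≤ κ * (E + Δt * ∑ j, |a i j| * e j) + r i := by
    intro i
    have hsum : ‖∑ j, a i j • (w j - wt j)‖ ≤ ∑ j, |a i j| * e j :=
      (norm_sum_le _ _).trans_eq (by simp [he, norm_smul])
    have harg : ‖(xp + Δt • ∑ j, a i j • w j) - (xtp + Δt • ∑ j, a i j • wt j)‖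
        ≤ E + Δt * ∑ j, |a i j| * e j := by
      have hsplit : (xp + Δt • ∑ j, a i j • w j) - (xtp + Δt • ∑ j, a i j • wt j)
          = (xp - xtp) + Δt • ∑ j, a i j • (w j - wt j) := by
        simp only [smul_sub, Finset.sum_sub_distrib]
        abel
      rw [hsplit]
      refine (norm_add_le _ _).trans ?_
      rw [norm_smul, Real.norm_of_nonneg hΔt.le]
      gcongr
    calc e i ≤ ‖w i - X (xtp + Δt • ∑ j, a i j • wt j)‖
          + ‖X (xtp + Δt • ∑ j, a i j • wt j) - wt i‖ := norm_sub_le_norm_sub_add_norm_sub _ _ _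
      _ ≤ κ * (E + Δt * ∑ j, |a i j| * e j) + r i := by
        rw [norm_sub_rev (X _) (wt i)]
        gcongr
        rw [hw i]
        exact (hLip _ _).trans (by gcongr)
  have hDe : ∀ i, (D *ᵥ e) i ≤ κ * E + r i := by
    intro i
    have hmul : (D *ᵥ e) i = e i - κ * Δt * ∑ j, |a i j| * e j := by
      simp [Matrix.mulVec, dotProduct, hDdef, sub_mul, Finset.sum_sub_distrib,
        Finset.mul_sum, mul_assoc]
    rw [hmul]
    linarith [hstage i]
  have hbound := ha2 e (fun i => κ * E + r i) (fun i => norm_nonneg _)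
    (fun i => by positivity) hDe
  have hsplit : x - xt = (xp - xtp) + Δt • ∑ m, b m • (w m - wt m)
      - (xt - xtp - Δt • ∑ i, b i • wt i) := by
    rw [hx]
    simp only [smul_sub, Finset.sum_sub_distrib]
    abel
  have hsum : ‖∑ m, b m • (w m - wt m)‖ ≤ ∑ m, |b m| * (D⁻¹ *ᵥ fun i => κ * E + r i) m := by
    refine (norm_sum_le _ _).trans (Finset.sum_le_sum fun m _ => ?_)
    rw [norm_smul, Real.norm_eq_abs]
    exact mul_le_mul_of_nonneg_left (hbound m) (abs_nonneg _)
  have hexpand : ∑ m, |b m| * (D⁻¹ *ᵥ fun i => κ * E + r i) m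
      = κ * E * (∑ m, |b m| * ∑ i, D⁻¹ m i) + ∑ m, |b m| * ∑ i, D⁻¹ m i * r i := by
    rw [Finset.mul_sum, ← Finset.sum_add_distrib]
    refine Finset.sum_congr rfl fun m _ => ?_
    simp only [Matrix.mulVec, dotProduct, mul_add, Finset.sum_add_distrib, ← Finset.sum_mul]
    ring
  rw [hexpand] at hsum
  rw [hsplit]
  calc _ ≤ E + Δt * ‖∑ m, b m • (w m - wt m)‖ + ‖xt - xtp - Δt • ∑ i, b i • wt i‖ := by
        refine (norm_sub_le _ _).trans ?_
        gcongr
        refine (norm_add_le _ _).trans ?_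
        rw [norm_smul, Real.norm_of_nonneg hΔt.le]
    _ ≤ _ := by linarith [mul_le_mul_of_nonneg_left hsum hΔt.le]
end
end

section
/- (A-posteriori error bound.) Let M, s, K ∈ ℕ, let X: ℝ^M → ℝ^M be Lipschitz continuous with constant κ > 0, let Δt > 0, and let a_{ij}, b_i ∈ ℝ (i,j = 1,…,s). Define D ∈ ℝ^{s×s} by d_{ij} := δ_{ij} − κ Δt |a_{ij}| and assume (a1) D is invertible and (a2) for all x, y ∈ ℝ^s with nonnegative entries, D x ≤ y componentwise implies x ≤ D⁻¹ y componentwise. Let (x^k)_{k=0}^K in ℝ^M and stage values w_i^k ∈ ℝ^M satisfy, for 1 ≤ k ≤ K and i = 1,…,s, w_i^k = X(x^{k−1} + Δt Σ_{j=1}^s a_{ij} w_j^k) and x^k = x^{k−1} + Δt Σ_{i=1}^s b_i w_i^k. Let (x̃^k)_{k=0}^K in ℝ^M and w̃_i^k ∈ ℝ^M be arbitrary sequences and define r̃_i^k := w̃_i^k − X(x̃^{k−1} + Δt Σ_{j=1}^s a_{ij} w̃_j^k) and r̃_x^k := x̃^k − x̃^{k−1} − Δt Σ_{i=1}^s b_i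 w̃_i^k. Then, with c₁ := 1 + κ Δt Σ_{m=1}^s |b_m| Σ_{i=1}^s [D⁻¹]_{mi}, for every 1 ≤ k ≤ K: ‖x^k − x̃^k‖₂ ≤ c₁^k ‖x^0 − x̃^0‖₂ + Σ_{ℓ=0}^{k−1} c₁^ℓ ( Δt Σ_{m=1}^s |b_m| Σ_{i=1}^s [D⁻¹]_{mi} ‖r̃_i^{k−ℓ}‖₂ + ‖r̃_x^{k−ℓ}‖₂ ). -/
open Matrix

noncomputable section

/-- Discrete Gronwall inequality on the index range `1, …, K`. -/
theorem le_pow_mul_add_sum_of_le_mul_pred_add {c : ℝ} (hc : 0 ≤ c) {e g : ℕ → ℝ} {K : ℕ}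
    (h : ∀ k, 1 ≤ k → k ≤ K → e k ≤ c * e (k - 1) + g k) :
    ∀ k, k ≤ K → e k ≤ c ^ k * e 0 + ∑ l ∈ Finset.range k, c ^ l * g (k - l) := by
  intro k
  induction k with
  | zero => simp
  | succ n ih =>
    intro hn
    calc e (n + 1) ≤ c * e n + g (n + 1) := h (n + 1) (by lia) hn
      _ ≤ c * (c ^ n * e 0 + ∑ l ∈ Finset.range n, c ^ l * g (n - l)) + g (n + 1) := by
          gcongr
          exact ih (by lia)
      _ = c ^ (n + 1) * e 0 + ∑ l ∈ Finset.range (n + 1), c ^ l * g (n + 1 - l) := by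
          rw [Finset.sum_range_succ', mul_add, Finset.mul_sum]
          simp only [pow_succ', mul_assoc, Nat.add_sub_add_right, pow_zero, one_mul, Nat.sub_zero]
          ring

/-- The norm of a weighted sum is at most the sum of the norms weighted by absolute values. -/
theorem norm_sum_smul_le_sum_abs_mul_norm {ι E : Type*} [Fintype ι] [SeminormedAddCommGroup E]
    [NormedSpace ℝ E] (c : ι → ℝ) (v : ι → E) :
    ‖∑ i, c i • v i‖ ≤ ∑ i, |c i| * ‖v i‖ :=
  (norm_sum_le _ _).trans_eq (by simp only [norm_smul, Real.norm_eq_abs])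

/-- The error of a Runge-Kutta stage in terms of the initial error, the stage errors and the
stage residual. -/
theorem norm_stage_sub_le {ι E : Type*} [Fintype ι] [SeminormedAddCommGroup E]
    [NormedSpace ℝ E] {X : E → E} {κ h : ℝ} (hκ : 0 ≤ κ) (hh : 0 ≤ h)
    (hLip : ∀ x y, ‖X x - X y‖ ≤ κ * ‖x - y‖) (a : ι → ℝ) (x xt : E) (w wt : ι → E) (u : E) :
    ‖X (x + h • ∑ j, a j • w j) - u‖ ≤
      κ * (‖x - xt‖ + h * ∑ j, |a j| * ‖w j - wt j‖) + ‖u - X (xt + h • ∑ j, a j • wt j)‖ := by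
  have harg : ‖(x + h • ∑ j, a j • w j) - (xt + h • ∑ j, a j • wt j)‖ ≤
      ‖x - xt‖ + h * ∑ j, |a j| * ‖w j - wt j‖ := by
    have heq : (x + h • ∑ j, a j • w j) - (xt + h • ∑ j, a j • wt j) =
        (x - xt) + h • ∑ j, a j • (w j - wt j) := by
      simp only [smul_sub, Finset.sum_sub_distrib]
      abel
    rw [heq]
    refine (norm_add_le _ _).trans ?_
    rw [norm_smul, Real.norm_of_nonneg hh]
    gcongr
    exact norm_sum_smul_le_sum_abs_mul_norm _ _
  calc ‖X (x + h • ∑ j, a j • w j) - u‖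
      ≤ ‖X (x + h • ∑ j, a j • w j) - X (xt + h • ∑ j, a j • wt j)‖
          + ‖X (xt + h • ∑ j, a j • wt j) - u‖ := norm_sub_le_norm_sub_add_norm_sub _ _ _
    _ ≤ _ := by
      rw [norm_sub_rev _ u]
      gcongr
      exact (hLip _ _).trans (by gcongr)

/-- The error of a Runge-Kutta update in terms of the initial error, the stage errors and the
state residual. -/
theorem norm_update_sub_le {ι E : Type*} [Fintype ι] [SeminormedAddCommGroup E]
    [NormedSpace ℝ E] {h : ℝ} (hh : 0 ≤ h) (b : ι → ℝ) (x xt : E) (w wt : ι → E) (u : E) :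
    ‖x + h • ∑ i, b i • w i - u‖ ≤
      ‖x - xt‖ + h * ∑ i, |b i| * ‖w i - wt i‖ + ‖u - xt - h • ∑ i, b i • wt i‖ := by
  have heq : x + h • ∑ i, b i • w i - u =
      (x - xt) + h • ∑ i, b i • (w i - wt i) - (u - xt - h • ∑ i, b i • wt i) := by
    simp only [smul_sub, Finset.sum_sub_distrib]
    abel
  rw [heq]
  refine (norm_sub_le _ _).trans ?_
  gcongr
  refine (norm_add_le _ _).trans ?_
  rw [norm_smul, Real.norm_of_nonneg hh]
  gcongr
  exact norm_sum_smul_le_sum_abs_mul_norm _ _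

/-- Rigorous a-posteriori error bound for Runge-Kutta schemes: for `1 ≤ k ≤ K`, the error
between the Runge-Kutta solution `x^k` and an arbitrary approximation `x̃^k` is bounded by
`c₁^k ‖x^0 - x̃^0‖₂ + Σ_{ℓ=0}^{k-1} c₁^ℓ (Δt Σ_m |b_m| Σ_i [D⁻¹]_{mi} ‖r̃_i^{k-ℓ}‖₂ + ‖r̃_x^{k-ℓ}‖₂)`
with `c₁ = 1 + κ Δt Σ_m |b_m| Σ_i [D⁻¹]_{mi}`, where
`r̃_i^k = w̃_i^k - X(x̃^{k-1} + Δt Σ_j a_{ij} w̃_j^k)` are the stage residuals and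
`r̃_x^k = x̃^k - x̃^{k-1} - Δt Σ_i b_i w̃_i^k` are the state residuals. -/
theorem rk_a_posteriori_error_bound (M s K : ℕ)
    (X : EuclideanSpace ℝ (Fin M) → EuclideanSpace ℝ (Fin M))
    (κ : ℝ) (hκ : 0 < κ)
    (hLip : ∀ x y : EuclideanSpace ℝ (Fin M), ‖X x - X y‖ ≤ κ * ‖x - y‖)
    (Δt : ℝ) (hΔt : 0 < Δt)
    (a : Fin s → Fin s → ℝ) (b : Fin s → ℝ)
    (D : Matrix (Fin s) (Fin s) ℝ)
    (hDdef : ∀ i j, D i j = (if i = j then (1 : ℝ) else 0) - κ * Δt * |a i j|)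
    (ha1 : IsUnit D.det)
    (ha2 : ∀ x y : Fin s → ℝ, (∀ i, 0 ≤ x i) → (∀ i, 0 ≤ y i) →
      (∀ i, (D *ᵥ x) i ≤ y i) → ∀ i, x i ≤ (D⁻¹ *ᵥ y) i)
    (x : ℕ → EuclideanSpace ℝ (Fin M)) (w : ℕ → Fin s → EuclideanSpace ℝ (Fin M))
    (hw : ∀ k, 1 ≤ k → k ≤ K → ∀ i, w k i = X (x (k - 1) + Δt • ∑ j, a i j • w k j))
    (hx : ∀ k, 1 ≤ k → k ≤ K → x k = x (k - 1) + Δt • ∑ i, b i • w k i)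
    (xt : ℕ → EuclideanSpace ℝ (Fin M)) (wt : ℕ → Fin s → EuclideanSpace ℝ (Fin M)) :
    ∀ k, 1 ≤ k → k ≤ K →
      ‖x k - xt k‖ ≤
        (1 + κ * Δt * ∑ m, |b m| * ∑ i, D⁻¹ m i) ^ k * ‖x 0 - xt 0‖
          + ∑ l ∈ Finset.range k, (1 + κ * Δt * ∑ m, |b m| * ∑ i, D⁻¹ m i) ^ l *
              (Δt * ∑ m, |b m| * ∑ i, D⁻¹ m i *
                  ‖wt (k - l) i - X (xt (k - l - 1) + Δt • ∑ j, a i j • wt (k - l) j)‖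
                + ‖xt (k - l) - xt (k - l - 1) - Δt • ∑ i, b i • wt (k - l) i‖) := by
  have hrow : ∀ m, 0 ≤ ∑ i, D⁻¹ m i := fun m => by
    simpa [mulVec, dotProduct] using
      ha2 0 1 (fun _ => le_rfl) (fun _ => zero_le_one) (fun i => by simp) m
  have hc : 0 ≤ 1 + κ * Δt * ∑ m, |b m| * ∑ i, D⁻¹ m i := by
    have : 0 ≤ ∑ m, |b m| * ∑ i, D⁻¹ m i :=
      Finset.sum_nonneg fun m _ => mul_nonneg (abs_nonneg _) (hrow m)
    positivity
  intro k _ hkK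
  refine le_pow_mul_add_sum_of_le_mul_pred_add hc (e := fun k => ‖x k - xt k‖)
    (g := fun n => Δt * ∑ m, |b m| * ∑ i, D⁻¹ m i *
        ‖wt n i - X (xt (n - 1) + Δt • ∑ j, a i j • wt n j)‖
      + ‖xt n - xt (n - 1) - Δt • ∑ i, b i • wt n i‖) (fun n hn hnK => ?_) k hkK
  set δ := ‖x (n - 1) - xt (n - 1)‖
  set r : Fin s → ℝ := fun i => ‖wt n i - X (xt (n - 1) + Δt • ∑ j, a i j • wt n j)‖
  have hstage : ∀ m, ‖w n m - wt n m‖ ≤ κ * δ * ∑ i, D⁻¹ m i + ∑ i, D⁻¹ m i * r i := by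
    intro m
    refine (ha2 (fun i => ‖w n i - wt n i‖) (fun i => κ * δ + r i) (fun i => norm_nonneg _)
      (fun i => by positivity) (fun i => ?_) m).trans_eq ?_
    · have hi := norm_stage_sub_le hκ.le hΔt.le hLip (a i) (x (n - 1)) (xt (n - 1)) (w n) (wt n)
        (wt n i)
      rw [← hw n hn hnK i] at hi
      have hD : (D *ᵥ fun i => ‖w n i - wt n i‖) i =
          ‖w n i - wt n i‖ - κ * (Δt * ∑ j, |a i j| * ‖w n j - wt n j‖) := by
        simp [mulVec, dotProduct, hDdef, sub_mul, Finset.sum_sub_distrib, Finset.mul_sum, mul_assoc]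
      rw [hD]
      linarith
    · simp only [mulVec, dotProduct, mul_add, Finset.sum_add_distrib, ← Finset.sum_mul]
      ring
  have hupdate := norm_update_sub_le hΔt.le b (x (n - 1)) (xt (n - 1)) (w n) (wt n) (xt n)
  rw [← hx n hn hnK] at hupdate
  have hsum : ∑ m, |b m| * ‖w n m - wt n m‖ ≤
      κ * δ * (∑ m, |b m| * ∑ i, D⁻¹ m i) + ∑ m, |b m| * ∑ i, D⁻¹ m i * r i := by
    rw [Finset.mul_sum, ← Finset.sum_add_distrib]
    refine Finset.sum_le_sum fun m _ => ?_
    calc |b m| * ‖w n m - wt n m‖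
        ≤ |b m| * (κ * δ * ∑ i, D⁻¹ m i + ∑ i, D⁻¹ m i * r i) := by
          gcongr
          exact hstage m
      _ = _ := by ring
  have := mul_le_mul_of_nonneg_left hsum hΔt.le
  linarith
end
end
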